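/- arXiv:math-ph/0601008 — 3 statements merged into one kernel-verified Lean document; each statement's English description precedes it below -/
import Mathlib

section
/- (Theorem 2.3 and Corollary 2.4: unique nonresonant eigenvalue in the first step.) For sufficiently large k (depending only on l, δ, b₁, b₂, C_W) the following holds. Suppose t ∈ ℝ² and j ∈ ℤ² satisfy | |t+p_j(0)|² − k² | < 5·k^{−4s₁−2δ} and | |t+p_j(0)|² − |t+p_i(0)|² | > 2·k^{−4s₁−δ} for every i ∈ ℤ² with i ≠ j. Then for every α ∈ [−1,1] the operator H_α(t) has exactly one eigenvalue λ_j^{(1)}(α,t) in the interval (k^{2l} − k^{2l−2−4s₁−δ}, k^{2l} + k^{2l−2−4s₁−δ}); this eigenvalue is simple, and it satisfies |λ_j^{(1)}(α,t) − |t+p_j(0)|^{2l}| ≤ 2·α²·k^{2l−2−4s₁−2γ₀−δ}, where γ₀ = 2l−2−4s₁−2δ. -/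
open Real Set

noncomputable section

/-- `s₁ = (2l-11)/32`. -/
def s1 (l : ℕ) : ℝ := (2 * (l : ℝ) - 11) / 32

/-- The dual-lattice point `p_m(0) = (2πm₁/a₁, 2πm₂/a₂)`. -/
def pvec (a₁ a₂ : ℝ) (m : ℤ × ℤ) : ℝ × ℝ := (2 * π * m.1 / a₁, 2 * π * m.2 / a₂)

/-- Squared Euclidean norm on `ℝ²`. -/
def sq2 (v : ℝ × ℝ) : ℝ := v.1 ^ 2 + v.2 ^ 2

/-- The bilinear square `|y|²_* = y₁² + y₂²` on `ℂ²` (no conjugation). -/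
def nsq (v : ℂ × ℂ) : ℂ := v.1 ^ 2 + v.2 ^ 2

/-- Complexification of a real vector. -/
def cx (x : ℝ × ℝ) : ℂ × ℂ := ((x.1 : ℂ), (x.2 : ℂ))

/-- Euclidean norm on `ℂ²`. -/
def cnorm (v : ℂ × ℂ) : ℝ := Real.sqrt (‖v.1‖ ^ 2 + ‖v.2‖ ^ 2)

/-- `γ₀ = 2l - 2 - 4s₁ - 2δ`. -/
def gam0 (l : ℕ) (δ : ℝ) : ℝ := 2 * (l : ℝ) - 2 - 4 * s1 l - 2 * δ

/-- A solution `f ∈ ℓ²(ℤ²)` of the eigenvalue equation with diagonal part `pw`,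
off-diagonal matrix `M` (acting by convolution) and spectral parameter `lam`;
the series involved are required to converge absolutely. -/
def IsSolution (pw : ℤ × ℤ → ℂ) (M : ℤ × ℤ → ℂ) (lam : ℂ) (f : ℤ × ℤ → ℂ) : Prop :=
  Memℓp f 2 ∧ (∀ m : ℤ × ℤ, Summable fun q : ℤ × ℤ => ‖M (m - q) * f q‖) ∧
    ∀ m : ℤ × ℤ, pw m * f m + ∑' q : ℤ × ℤ, M (m - q) * f q = lam * f m

/-- `lam` is an eigenvalue: there is a nonzero `ℓ²` solution. -/
def IsEigenvalue (pw : ℤ × ℤ → ℂ) (M : ℤ × ℤ → ℂ) (lam : ℂ) : Prop :=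
  ∃ f : ℤ × ℤ → ℂ, IsSolution pw M lam f ∧ f ≠ 0

/-- `lam` is a simple eigenvalue: the space of `ℓ²` solutions is one-dimensional. -/
def IsSimpleEigenvalue (pw : ℤ × ℤ → ℂ) (M : ℤ × ℤ → ℂ) (lam : ℂ) : Prop :=
  ∃ f : ℤ × ℤ → ℂ, IsSolution pw M lam f ∧ f ≠ 0 ∧
    ∀ g : ℤ × ℤ → ℂ, IsSolution pw M lam g → ∃ c : ℂ, g = c • f

/-- Fourier coefficients of a periodic function `W` on the cell `[0,a₁] × [0,a₂]`. -/
def fCoeff (a₁ a₂ : ℝ) (W : ℝ × ℝ → ℝ) (j : ℤ × ℤ) : ℂ :=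
  ((a₁ * a₂ : ℝ) : ℂ)⁻¹ *
    ∫ x in Icc (0 : ℝ × ℝ) (a₁, a₂),
      (W x : ℂ) *
        Complex.exp (-Complex.I * (((pvec a₁ a₂ j).1 * x.1 + (pvec a₁ a₂ j).2 * x.2 : ℝ) : ℂ))

theorem exists_multiplication_operator {X : Type*} [MeasurableSpace X] (μ : MeasureTheory.Measure X)
    (W : X → ℝ) (hW : Measurable W) (C : ℝ) (hb : ∀ x, |W x| ≤ C) :
    ∃ M : MeasureTheory.Lp ℂ 2 μ →L[ℂ] MeasureTheory.Lp ℂ 2 μ,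
      (∀ f, ‖M f‖ ≤ C * ‖f‖) ∧ (∀ f, M f =ᵐ[μ] fun x => (W x : ℂ) * f x) ∧
      ∀ f g, inner ℂ (M f) g = inner ℂ f (M g) := by
  have hmem : MeasureTheory.MemLp (fun x => (W x : ℂ)) ⊤ μ :=
    MeasureTheory.memLp_top_of_bound (Complex.measurable_ofReal.comp hW).aestronglyMeasurable C
      (.of_forall fun x => by simpa using hb x)
  let M : MeasureTheory.Lp ℂ 2 μ →L[ℂ] MeasureTheory.Lp ℂ 2 μ :=
    (ContinuousLinearMap.mul ℂ ℂ).holderL μ ⊤ 2 2 hmem.toLp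
  have hM : ∀ f, M f =ᵐ[μ] fun x => (W x : ℂ) * f x := fun f => by
    filter_upwards [(ContinuousLinearMap.mul ℂ ℂ).coeFn_holder (r := 2) hmem.toLp f,
      hmem.coeFn_toLp] with x h1 h2
    rw [ContinuousLinearMap.mul_apply', h2] at h1
    exact h1
  refine ⟨M, fun f => ?_, hM, fun f g => ?_⟩
  · refine MeasureTheory.Lp.norm_le_mul_norm_of_ae_le_mul ?_
    filter_upwards [hM f] with x hx
    rw [hx, norm_mul, Complex.norm_real]
    exact mul_le_mul_of_nonneg_right (hb x) (norm_nonneg _)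
  · rw [MeasureTheory.L2.inner_def, MeasureTheory.L2.inner_def]
    refine MeasureTheory.integral_congr_ae ?_
    filter_upwards [hM f, hM g] with x hx hy
    simp only [hx, hy, RCLike.inner_apply, map_mul, Complex.conj_ofReal]
    ring

theorem exists_matrix_operator {X ι : Type*} [MeasurableSpace X] [DecidableEq ι]
    (μ : MeasureTheory.Measure X)
    (W : X → ℝ) (hW : Measurable W) (C : ℝ) (hb : ∀ x, |W x| ≤ C)
    (e : ι → X → ℂ) (he : ∀ i, MeasureTheory.MemLp (e i) 2 μ)
    (horth : ∀ i j, ∫ x, e j x * (starRingEnd ℂ) (e i x) ∂μ = if i = j then 1 else 0) :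
    ∃ T : lp (fun _ : ι => ℂ) 2 →L[ℂ] lp (fun _ : ι => ℂ) 2,
      (∀ f, ‖T f‖ ≤ C * ‖f‖) ∧ (∀ f g, inner ℂ (T f) g = inner ℂ f (T g)) ∧
      ∀ m q, T (lp.single 2 q 1) m = ∫ x, (W x : ℂ) * e q x * (starRingEnd ℂ) (e m x) ∂μ := by
  obtain ⟨M, hM, hMae, hsymm⟩ := exists_multiplication_operator μ W hW C hb
  have hon : Orthonormal ℂ fun i => (he i).toLp := by
    rw [orthonormal_iff_ite]
    intro i j
    rw [← horth, MeasureTheory.L2.inner_def]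
    refine MeasureTheory.integral_congr_ae ?_
    filter_upwards [(he i).coeFn_toLp, (he j).coeFn_toLp] with x hx hy
    simp [hx, hy]
  let V := hon.orthogonalFamily.linearIsometry
  have hV : ∀ i, V (lp.single 2 i 1) = (he i).toLp := fun i => by
    simp [V, OrthogonalFamily.linearIsometry_apply_single]
  let Vc := V.toContinuousLinearMap
  have hVc : ∀ f, Vc f = V f := fun _ => rfl
  refine ⟨Vc.adjoint ∘L M ∘L Vc, fun f => ?_, fun f g => ?_, fun m q => ?_⟩
  · have h1 : ‖Vc.adjoint‖ ≤ 1 := by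
      rw [LinearIsometryEquiv.norm_map]
      exact V.norm_toContinuousLinearMap_le
    calc ‖Vc.adjoint (M (Vc f))‖ ≤ ‖Vc.adjoint‖ * ‖M (Vc f)‖ := Vc.adjoint.le_opNorm _
      _ ≤ 1 * (C * ‖Vc f‖) := by gcongr; exact hM _
      _ = C * ‖f‖ := by rw [one_mul, hVc, V.norm_map]
  · simp [ContinuousLinearMap.adjoint_inner_left, ContinuousLinearMap.adjoint_inner_right, hsymm]
  · have h : inner ℂ (lp.single (E := fun _ : ι => ℂ) 2 m (1 : ℂ)) ((Vc.adjoint ∘L M ∘L Vc) (lp.single 2 q 1))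
        = (Vc.adjoint ∘L M ∘L Vc) (lp.single 2 q 1) m := by
      rw [lp.inner_single_left]; simp
    rw [← h]
    simp only [ContinuousLinearMap.comp_apply, ContinuousLinearMap.adjoint_inner_right]
    rw [hVc, hVc, hV, hV, MeasureTheory.L2.inner_def]
    refine MeasureTheory.integral_congr_ae ?_
    filter_upwards [(he m).coeFn_toLp, (he q).coeFn_toLp, hMae (he q).toLp] with x hx hy hz
    simp [hx, hy, hz]

theorem hasSum_symmetric_operator {ι : Type*} [DecidableEq ι]
    (T : lp (fun _ : ι => ℂ) 2 →L[ℂ] lp (fun _ : ι => ℂ) 2)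
    (hT : ∀ f g, inner ℂ (T f) g = inner ℂ f (T g)) (f : lp (fun _ : ι => ℂ) 2) (m : ι) :
    HasSum (fun q => T (lp.single 2 q 1) m * f q) (T f m) := by
  have h1 : inner ℂ (lp.single (E := fun _ : ι => ℂ) 2 m (1 : ℂ)) (T f) = T f m := by
    rw [lp.inner_single_left]; simp
  have h2 : ∀ q, (starRingEnd ℂ) (T (lp.single 2 m 1) q) = T (lp.single 2 q 1) m := fun q => by
    have := hT (lp.single (E := fun _ : ι => ℂ) 2 m (1 : ℂ)) (lp.single 2 q 1)
    rw [lp.inner_single_left, lp.inner_single_right] at this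
    simpa using this
  have h3 := lp.hasSum_inner (𝕜 := ℂ) (T (lp.single (E := fun _ : ι => ℂ) 2 m (1 : ℂ))) f
  rw [hT, h1] at h3
  have h4 : (fun q => T (lp.single 2 q 1) m * f q)
      = fun q => inner ℂ (T (lp.single 2 m 1) q) (f q) := by
    funext q
    rw [← h2 q, RCLike.inner_apply, mul_comm]
  rw [h4]
  exact h3

section Perturbation

variable {ι : Type*}

theorem lp_two_norm_le_mul (x y : lp (fun _ : ι => ℂ) 2) (K : ℝ) (hK : 0 ≤ K)
    (h : ∀ i, ‖x i‖ ≤ K * ‖y i‖) : ‖x‖ ≤ K * ‖y‖ := by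
  have h1 : ‖x‖ ≤ ‖(K : ℂ) • y‖ := by
    refine lp.norm_mono (by norm_num) fun i => ?_
    rw [lp.coeFn_smul, Pi.smul_apply, norm_smul, Complex.norm_real, Real.norm_of_nonneg hK]
    exact h i
  rwa [norm_smul, Complex.norm_real, Real.norm_of_nonneg hK] at h1

theorem exists_lp_two_mul (u : ι → ℂ) (K : ℝ) (hu : ∀ i, ‖u i‖ ≤ K)
    (y : lp (fun _ : ι => ℂ) 2) : ∃ x : lp (fun _ : ι => ℂ) 2, ∀ i, x i = u i * y i := by
  refine ⟨⟨fun i => u i * y i, ?_⟩, fun i => rfl⟩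
  have h := (lp.memℓp ((K : ℂ) • y))
  refine h.mono' (E := fun _ => ℂ) fun i => ?_
  rw [lp.coeFn_smul, Pi.smul_apply, norm_smul, norm_mul, Complex.norm_real]
  exact mul_le_mul_of_nonneg_right ((hu i).trans (le_abs_self K)) (norm_nonneg _)

theorem eigenvalue_real (d : ι → ℝ)
    (S : lp (fun _ : ι => ℂ) 2 →L[ℂ] lp (fun _ : ι => ℂ) 2)
    (hS : ∀ f g, inner ℂ (S f) g = inner ℂ f (S g)) (z : ℂ) (f : lp (fun _ : ι => ℂ) 2)
    (hf : f ≠ 0) (h : ∀ m, (d m : ℂ) * f m + S f m = z * f m) : ∃ x : ℝ, (x : ℂ) = z := by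
  have h1 : ∀ m, (z • f - S f) m = (d m : ℂ) * f m := fun m => by
    have := h m
    simp only [lp.coeFn_sub, lp.coeFn_smul, Pi.sub_apply, Pi.smul_apply, smul_eq_mul]
    linear_combination -this
  have h2 : inner ℂ (z • f - S f) f = inner ℂ f (z • f - S f) := by
    rw [lp.inner_eq_tsum, lp.inner_eq_tsum]
    refine tsum_congr fun m => ?_
    rw [h1, RCLike.inner_apply, RCLike.inner_apply, map_mul]
    simp only [Complex.conj_ofReal]
    ring
  rw [inner_sub_left, inner_sub_right, hS, inner_smul_left, inner_smul_right] at h2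
  have h3 : (starRingEnd ℂ) z = z := by
    have : inner ℂ f f ≠ (0 : ℂ) := inner_self_ne_zero.mpr hf
    exact mul_right_cancel₀ this (sub_left_inj.mp h2)
  exact Complex.conj_eq_iff_real.mp h3 |>.imp fun _ h => h.symm

variable [DecidableEq ι]

theorem norm_sub_single_le (d : ι → ℝ) (j : ι)
    (S : lp (fun _ : ι => ℂ) 2 →L[ℂ] lp (fun _ : ι => ℂ) 2) (c r : ℝ)
    (hr : 0 < r) (hcr : 16 * c ≤ r) (hS : ∀ f, ‖S f‖ ≤ c * ‖f‖)
    (z : ℝ) (hz : ∀ i ≠ j, r / 2 ≤ |d i - z|) (g : lp (fun _ : ι => ℂ) 2)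
    (hg : ∀ m, (d m : ℂ) * g m + S g m = z * g m) :
    ‖g - lp.single 2 j (g j)‖ ≤ ‖g‖ / 8 := by
  have h1 : ‖g - lp.single 2 j (g j)‖ ≤ 2 / r * ‖S g‖ := by
    refine lp_two_norm_le_mul _ _ _ (by positivity) fun i => ?_
    rw [lp.coeFn_sub, Pi.sub_apply]
    by_cases hi : i = j
    · subst hi
      rw [lp.single_apply_self, sub_self, norm_zero]
      positivity
    · rw [lp.single_apply_ne _ _ _ hi, sub_zero]
      have h2 : S g i = -(((d i - z : ℝ) : ℂ) * g i) := by
        have := hg i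
        push_cast
        linear_combination this
      rw [h2, norm_neg, norm_mul, Complex.norm_real, Real.norm_eq_abs, div_mul_eq_mul_div,
        le_div_iff₀ hr]
      nlinarith [hz i hi, norm_nonneg (g i)]
  have h3 : 2 / r * ‖S g‖ ≤ 2 / r * (c * ‖g‖) := by gcongr; exact hS g
  have h4 : 2 / r * (c * ‖g‖) ≤ ‖g‖ / 8 := by
    rw [div_mul_eq_mul_div, div_le_iff₀ hr]
    nlinarith [norm_nonneg g]
  linarith

theorem exists_unique_perturbed_eigenpair (d : ι → ℝ) (j : ι)
    (S : lp (fun _ : ι => ℂ) 2 →L[ℂ] lp (fun _ : ι => ℂ) 2) (c r E : ℝ)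
    (hc : 0 ≤ c) (hr : 0 < r) (hcr : 16 * c ≤ r) (hS : ∀ f, ‖S f‖ ≤ c * ‖f‖)
    (hsymm : ∀ f g, inner ℂ (S f) g = inner ℂ f (S g))
    (hjj : S (lp.single 2 j 1) j = 0)
    (hdj : |d j - E| ≤ r / 4) (hdi : ∀ i ≠ j, 3 * r / 2 ≤ |d i - E|) :
    ∃ (x : ℝ) (f : lp (fun _ : ι => ℂ) 2), |x - E| < r ∧ f j = 1 ∧
      (∀ m, (d m : ℂ) * f m + S f m = x * f m) ∧ |x - d j| ≤ 2 * c ^ 2 / r ∧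
      ∀ (z : ℝ) (g : lp (fun _ : ι => ℂ) 2), |z - E| < r →
        (∀ m, (d m : ℂ) * g m + S g m = z * g m) → g ≠ 0 → z = x ∧ g = g j • f := by
  set e : lp (fun _ : ι => ℂ) 2 := lp.single 2 j 1 with he
  have hej : e j = 1 := lp.single_apply_self _ _ _
  have hei : ∀ i ≠ j, e i = 0 := fun i hi => lp.single_apply_ne _ _ _ hi
  have hen : ‖e‖ = 1 := by rw [he, lp.norm_single (by norm_num)]; simp
  have hcomp : ∀ (y : lp (fun _ : ι => ℂ) 2) i, ‖y i‖ ≤ ‖y‖ :=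
    fun y i => lp.norm_apply_le_norm (by norm_num) y i
  let ev : lp (fun _ : ι => ℂ) 2 → ℂ := fun g => d j + S g j
  have hev : ∀ g, ‖g‖ ≤ 1 → ∀ i ≠ j, r ≤ ‖(d i : ℂ) - ev g‖ := fun g hg i hi => by
    have h1 : ‖S g j‖ ≤ c := (hcomp _ _).trans ((hS g).trans (mul_le_of_le_one_right hc hg))
    have h2 : ‖((d i - E : ℝ) : ℂ)‖ ≤ ‖(d i : ℂ) - ev g‖ + (‖((d j - E : ℝ) : ℂ)‖ + ‖S g j‖) := by
      refine le_trans (le_of_eq ?_) (norm_add_le_of_le le_rfl (norm_add_le _ _))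
      congr 1
      simp only [ev]
      push_cast
      ring
    rw [Complex.norm_real, Complex.norm_real, Real.norm_eq_abs, Real.norm_eq_abs] at h2
    linarith [hdi i hi]
  let u : lp (fun _ : ι => ℂ) 2 → ι → ℂ := fun g i => if i = j then 0 else -((d i : ℂ) - ev g)⁻¹
  have hu : ∀ g, ‖g‖ ≤ 1 → ∀ i, ‖u g i‖ ≤ r⁻¹ := fun g hg i => by
    by_cases hi : i = j
    · simp [u, hi, hr.le]
    · simp only [u, hi, if_false, norm_neg, norm_inv]
      exact inv_anti₀ hr (hev g hg i hi)
  have huu : ∀ g g', ‖g‖ ≤ 1 → ‖g'‖ ≤ 1 → ∀ i, ‖u g i - u g' i‖ ≤ c * ‖g - g'‖ / r ^ 2 :=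
    fun g g' hg hg' i => by
    by_cases hi : i = j
    · simp only [u, hi, if_true, sub_self, norm_zero]; positivity
    · have h1 := hev g hg i hi
      have h2 := hev g' hg' i hi
      have n1 : (d i : ℂ) - ev g ≠ 0 := norm_pos_iff.mp (hr.trans_le h1)
      have n2 : (d i : ℂ) - ev g' ≠ 0 := norm_pos_iff.mp (hr.trans_le h2)
      have h3 : u g i - u g' i = -(S (g - g') j) / (((d i : ℂ) - ev g) * ((d i : ℂ) - ev g')) := by
        simp only [u, hi, if_false]
        rw [map_sub, lp.coeFn_sub, Pi.sub_apply]
        field_simp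
        simp only [ev]
        ring
      rw [h3, norm_div, norm_neg, norm_mul]
      refine div_le_div₀ (by positivity) ((hcomp _ _).trans (hS _)) (by positivity) ?_
      rw [sq]
      exact mul_le_mul h1 h2 hr.le (norm_nonneg _)
  have hΦ : ∀ g : lp (fun _ : ι => ℂ) 2, ∃ h : lp (fun _ : ι => ℂ) 2,
      ‖g‖ ≤ 1 → ∀ i, h i = u g i * S (e + g) i := fun g => by
    by_cases hg : ‖g‖ ≤ 1
    · obtain ⟨x, hx⟩ := exists_lp_two_mul (u g) _ (hu g hg) (S (e + g))
      exact ⟨x, fun _ => hx⟩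
    · exact ⟨0, fun h => absurd h hg⟩
  choose Φ hΦ using hΦ
  have hSe : ∀ g, ‖g‖ ≤ 1 → ‖S (e + g)‖ ≤ 2 * c := fun g hg => by
    refine (hS _).trans ?_
    have := norm_add_le e g
    nlinarith
  have hΦn : ∀ g, ‖g‖ ≤ 1 → ‖Φ g‖ ≤ r⁻¹ * (2 * c) := fun g hg => by
    refine (lp_two_norm_le_mul _ (S (e + g)) r⁻¹ (by positivity) fun i => ?_).trans ?_
    · rw [hΦ g hg, norm_mul]
      exact mul_le_mul_of_nonneg_right (hu g hg i) (norm_nonneg _)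
    · exact mul_le_mul_of_nonneg_left (hSe g hg) (by positivity)
  have hrc : r⁻¹ * c ≤ 1 / 16 := by
    rw [inv_mul_le_iff₀ hr]; linarith
  have hrc0 : 0 ≤ r⁻¹ * c := by positivity
  have hlip : ∀ g g', ‖g‖ ≤ 1 → ‖g'‖ ≤ 1 → ‖Φ g - Φ g'‖ ≤ 1 / 2 * ‖g - g'‖ :=
    fun g g' hg hg' => by
    obtain ⟨x, hx⟩ := exists_lp_two_mul (u g) _ (hu g hg) (S (g - g'))
    obtain ⟨y, hy⟩ := exists_lp_two_mul (fun i => u g i - u g' i) _ (huu g g' hg hg') (S (e + g'))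
    have h1 : Φ g - Φ g' = x + y := by
      ext i
      rw [lp.coeFn_sub, lp.coeFn_add, Pi.sub_apply, Pi.add_apply, hΦ g hg, hΦ g' hg', hx, hy]
      simp only [map_sub, map_add, lp.coeFn_sub, lp.coeFn_add, Pi.sub_apply, Pi.add_apply]
      ring
    have h2 : ‖x‖ ≤ r⁻¹ * (c * ‖g - g'‖) := by
      refine (lp_two_norm_le_mul _ (S (g - g')) r⁻¹ (by positivity) fun i => ?_).trans ?_
      · rw [hx, norm_mul]
        exact mul_le_mul_of_nonneg_right (hu g hg i) (norm_nonneg _)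
      · exact mul_le_mul_of_nonneg_left (hS _) (by positivity)
    have h3 : ‖y‖ ≤ c * ‖g - g'‖ / r ^ 2 * (2 * c) := by
      refine (lp_two_norm_le_mul _ (S (e + g')) (c * ‖g - g'‖ / r ^ 2) (by positivity)
        fun i => ?_).trans ?_
      · rw [hy, norm_mul]
        exact mul_le_mul_of_nonneg_right (huu g g' hg hg' i) (norm_nonneg _)
      · exact mul_le_mul_of_nonneg_left (hSe g' hg') (by positivity)
    have h4 : c * ‖g - g'‖ / r ^ 2 * (2 * c) = 2 * ((r⁻¹ * c) * (r⁻¹ * c)) * ‖g - g'‖ := by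
      field_simp
    have h5 : (r⁻¹ * c) * (r⁻¹ * c) ≤ 1 / 16 * (1 / 16) := mul_le_mul hrc hrc hrc0 (by norm_num)
    rw [h1]
    refine (norm_add_le x y).trans ?_
    rw [h4] at h3
    nlinarith [norm_nonneg (g - g')]
  have hfix : ∃ g, ‖g‖ ≤ 1 ∧ Φ g = g := by
    have hmaps : MapsTo Φ (Metric.closedBall 0 1) (Metric.closedBall 0 1) := fun g hg => by
      rw [mem_closedBall_zero_iff] at hg ⊢
      linarith [hΦn g hg]
    have hcontr : ContractingWith (1 / 2) (hmaps.restrict Φ _ _) := by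
      refine ⟨by rw [← NNReal.coe_lt_coe]; norm_num, LipschitzWith.of_dist_le_mul fun a b => ?_⟩
      rw [Subtype.dist_eq, Subtype.dist_eq, dist_eq_norm, dist_eq_norm]
      simpa using hlip a b (mem_closedBall_zero_iff.mp a.2) (mem_closedBall_zero_iff.mp b.2)
    obtain ⟨g, hg, hfg, -⟩ := hcontr.exists_fixedPoint' Metric.isClosed_closedBall.isComplete hmaps
      (x := 0) (by simp) (edist_ne_top _ _)
    exact ⟨g, mem_closedBall_zero_iff.mp hg, hfg⟩
  obtain ⟨g, hg, hgΦ⟩ := hfix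
  have hgj : g j = 0 := by rw [← hgΦ, hΦ g hg]; simp [u]
  have hgn : ‖g‖ ≤ r⁻¹ * (2 * c) := by simpa only [hgΦ] using hΦn g hg
  have hsol : ∀ m, (d m : ℂ) * (e + g) m + S (e + g) m = ev g * (e + g) m := fun m => by
    by_cases hm : m = j
    · subst hm
      simp only [map_add, lp.coeFn_add, Pi.add_apply, hej, hgj, hjj, ev]
      ring
    · have h1 : g m = u g m * S (e + g) m := by rw [← hΦ g hg, hgΦ]
      have n1 : (d m : ℂ) - ev g ≠ 0 := norm_pos_iff.mp (hr.trans_le (hev g hg m hm))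
      simp only [u, hm, if_false] at h1
      have h2 : ((d m : ℂ) - ev g) * g m = - S (e + g) m := by
        rw [h1]; field_simp
      rw [lp.coeFn_add, Pi.add_apply, hei m hm]
      linear_combination h2
  have hfj : (e + g) j = 1 := by rw [lp.coeFn_add, Pi.add_apply, hej, hgj, add_zero]
  have hne : e + g ≠ 0 := fun h => by
    rw [h] at hfj
    exact zero_ne_one hfj
  obtain ⟨x, hx⟩ := eigenvalue_real d S hsymm (ev g) (e + g) hne hsol
  have hxd : |x - d j| ≤ c * ‖g‖ := by
    have h1 : ((x - d j : ℝ) : ℂ) = S g j := by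
      push_cast
      rw [hx]
      simp [ev]
    rw [← Real.norm_eq_abs, ← Complex.norm_real, h1]
    exact (hcomp _ _).trans (hS g)
  refine ⟨x, e + g, ?_, hfj, fun m => by rw [hx]; exact hsol m, ?_, ?_⟩
  · have h1 : c * ‖g‖ ≤ c := mul_le_of_le_one_right hc hg
    have h2 := abs_sub_le x (d j) E
    linarith
  · refine hxd.trans ((mul_le_mul_of_nonneg_left hgn hc).trans (le_of_eq ?_))
    field_simp
  · intro z g' hz hg' hg'0
    have hz' : ∀ i ≠ j, r / 2 ≤ |d i - z| := fun i hi => by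
      have := abs_sub_le (d i) z E
      linarith [hdi i hi]
    have hg'j : g' j ≠ 0 := fun h => by
      have h1 := norm_sub_single_le d j S c r hr hcr hS z hz' g' hg'
      rw [h, lp.single_zero, sub_zero] at h1
      have := norm_pos_iff.mpr hg'0
      linarith
    set p := (g' j)⁻¹ • g' with hp
    have hpj : p j = 1 := by
      rw [hp, lp.coeFn_smul, Pi.smul_apply, smul_eq_mul, inv_mul_cancel₀ hg'j]
    have hps : ∀ m, (d m : ℂ) * p m + S p m = z * p m := fun m => by
      simp only [hp, map_smul, lp.coeFn_smul, Pi.smul_apply, smul_eq_mul]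
      linear_combination (g' j)⁻¹ * hg' m
    have h1 := norm_sub_single_le d j S c r hr hcr hS z hz' p hps
    rw [hpj, ← he] at h1
    have hq : ‖p - e‖ ≤ 1 := by
      have := norm_add_le (p - e) e
      rw [sub_add_cancel, hen] at this
      linarith
    have hevz : ev (p - e) = z := by
      have := hps j
      rw [hpj] at this
      simp only [ev, map_sub, lp.coeFn_sub, Pi.sub_apply, hjj]
      linear_combination this
    have hpf : Φ (p - e) = p - e := by
      ext i
      rw [hΦ _ hq, add_sub_cancel]
      by_cases hi : i = j
      · subst hi
        simp [u, hpj, hej]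
      · have n1 := norm_pos_iff.mp (hr.trans_le (hev _ hq i hi))
        rw [lp.coeFn_sub, Pi.sub_apply, hei i hi]
        simp only [u, hi, if_false]
        rw [hevz] at n1 ⊢
        field_simp
        linear_combination - hps i
    have h2 := hlip (p - e) g hq hg
    rw [hpf, hgΦ] at h2
    have h3 : p - e = g := by
      rw [← sub_eq_zero, ← norm_eq_zero]
      linarith [norm_nonneg (p - e - g)]
    refine ⟨?_, ?_⟩
    · rw [h3, ← hx] at hevz
      exact_mod_cast hevz.symm
    · rw [← h3, add_sub_cancel, hp, smul_smul, mul_inv_cancel₀ hg'j, one_smul]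

end Perturbation

theorem integral_exp_period (a : ℝ) (ha : 0 < a) (n : ℤ) :
    ∫ x in Icc 0 a, Complex.exp (-Complex.I * ((2 * π * n / a * x : ℝ) : ℂ)) =
      if n = 0 then (a : ℂ) else 0 := by
  rw [MeasureTheory.integral_Icc_eq_integral_Ioc, ← intervalIntegral.integral_of_le ha.le]
  split_ifs with hn
  · subst hn
    simp
  · have hc : -Complex.I * (2 * π * n / a : ℝ) ≠ 0 := by
      refine mul_ne_zero (neg_ne_zero.mpr Complex.I_ne_zero) (Complex.ofReal_ne_zero.mpr ?_)
      have : (n : ℝ) ≠ 0 := Int.cast_ne_zero.mpr hn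
      positivity
    have h1 : ∀ x : ℝ, Complex.exp (-Complex.I * ((2 * π * n / a * x : ℝ) : ℂ)) =
        Complex.exp (-Complex.I * (2 * π * n / a : ℝ) * x) := fun x => by
      push_cast
      ring_nf
    simp_rw [h1]
    rw [integral_exp_mul_complex hc, div_eq_zero_iff]
    left
    have h2 : -Complex.I * ((2 * π * n / a : ℝ) : ℂ) * (a : ℂ) = ((-n : ℤ) : ℂ) * (2 * π * Complex.I) := by
      have : (a : ℂ) ≠ 0 := Complex.ofReal_ne_zero.mpr ha.ne'
      push_cast
      field_simp
    rw [h2, Complex.exp_int_mul_two_pi_mul_I]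
    simp

theorem fCoeff_one (a₁ a₂ : ℝ) (h₁ : 0 < a₁) (h₂ : 0 < a₂) (n : ℤ × ℤ) :
    fCoeff a₁ a₂ (fun _ => 1) n = if n = 0 then 1 else 0 := by
  have h : ∀ x : ℝ × ℝ, (((1 : ℝ) : ℂ)) *
        Complex.exp (-Complex.I * (((pvec a₁ a₂ n).1 * x.1 + (pvec a₁ a₂ n).2 * x.2 : ℝ) : ℂ)) =
      Complex.exp (-Complex.I * ((2 * π * n.1 / a₁ * x.1 : ℝ) : ℂ)) *
        Complex.exp (-Complex.I * ((2 * π * n.2 / a₂ * x.2 : ℝ) : ℂ)) := fun x => by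
    rw [← Complex.exp_add, Complex.ofReal_one, one_mul, ← mul_add, ← Complex.ofReal_add]
    rfl
  unfold fCoeff
  simp_rw [h]
  rw [show Icc (0 : ℝ × ℝ) (a₁, a₂) = Icc 0 a₁ ×ˢ Icc 0 a₂ from (Icc_prod_Icc 0 a₁ 0 a₂).symm,
    MeasureTheory.Measure.volume_eq_prod,
    MeasureTheory.setIntegral_prod_mul
      (fun x : ℝ => Complex.exp (-Complex.I * ((2 * π * n.1 / a₁ * x : ℝ) : ℂ)))
      (fun x : ℝ => Complex.exp (-Complex.I * ((2 * π * n.2 / a₂ * x : ℝ) : ℂ))),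
    integral_exp_period a₁ h₁, integral_exp_period a₂ h₂]
  have e₁ : (a₁ : ℂ) ≠ 0 := Complex.ofReal_ne_zero.mpr h₁.ne'
  have e₂ : (a₂ : ℂ) ≠ 0 := Complex.ofReal_ne_zero.mpr h₂.ne'
  by_cases hn₁ : n.1 = 0 <;> by_cases hn₂ : n.2 = 0 <;> simp [Prod.ext_iff, hn₁, hn₂]
  field_simp

theorem exists_convolution_operator (a₁ a₂ : ℝ) (h₁ : 0 < a₁) (h₂ : 0 < a₂)
    (W : ℝ × ℝ → ℝ) (hW : Measurable W) (C : ℝ) (hb : ∀ x, |W x| ≤ C) :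
    ∃ T : lp (fun _ : ℤ × ℤ => ℂ) 2 →L[ℂ] lp (fun _ : ℤ × ℤ => ℂ) 2,
      (∀ f, ‖T f‖ ≤ C * ‖f‖) ∧ (∀ f g, inner ℂ (T f) g = inner ℂ f (T g)) ∧
      ∀ m q, T (lp.single 2 q 1) m = fCoeff a₁ a₂ W (m - q) := by
  let μ : MeasureTheory.Measure (ℝ × ℝ) := ENNReal.ofReal (a₁ * a₂)⁻¹ •
    MeasureTheory.volume.restrict (Icc (0 : ℝ × ℝ) (a₁, a₂))
  have : MeasureTheory.IsFiniteMeasure (MeasureTheory.volume.restrict (Icc (0 : ℝ × ℝ) (a₁, a₂))) :=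
    ⟨by simpa using isCompact_Icc.measure_lt_top⟩
  have : MeasureTheory.IsFiniteMeasure μ :=
    MeasureTheory.Measure.smul_finite _ ENNReal.ofReal_ne_top
  let e : ℤ × ℤ → ℝ × ℝ → ℂ := fun m x =>
    Complex.exp (Complex.I * (((pvec a₁ a₂ m).1 * x.1 + (pvec a₁ a₂ m).2 * x.2 : ℝ) : ℂ))
  have he : ∀ m, MeasureTheory.MemLp (e m) 2 μ := fun m => by
    refine MeasureTheory.MemLp.of_bound (Continuous.aestronglyMeasurable ?_) 1 (.of_forall fun x => ?_)
    · fun_prop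
    · simp only [e]
      rw [mul_comm, Complex.norm_exp_ofReal_mul_I]
  have hmul : ∀ m q x, e q x * (starRingEnd ℂ) (e m x) = Complex.exp (-Complex.I *
      (((pvec a₁ a₂ (m - q)).1 * x.1 + (pvec a₁ a₂ (m - q)).2 * x.2 : ℝ) : ℂ)) := fun m q x => by
    simp only [e]
    rw [← Complex.exp_conj, ← Complex.exp_add, map_mul, Complex.conj_I, Complex.conj_ofReal]
    congr 1
    simp only [pvec, Prod.fst_sub, Prod.snd_sub]
    push_cast
    ring
  have hint : ∀ (V : ℝ × ℝ → ℝ) m q,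
      ∫ x, (V x : ℂ) * (e q x * (starRingEnd ℂ) (e m x)) ∂μ = fCoeff a₁ a₂ V (m - q) :=
    fun V m q => by
    simp_rw [hmul]
    rw [MeasureTheory.integral_smul_measure, ENNReal.toReal_ofReal (by positivity), fCoeff,
      Complex.real_smul, Complex.ofReal_inv]
  obtain ⟨T, hT, hs, hm⟩ := exists_matrix_operator μ W hW C hb e he fun i j => by
    have h := hint (fun _ => 1) i j
    simp only [Complex.ofReal_one, one_mul] at h
    rw [h, fCoeff_one a₁ a₂ h₁ h₂]
    simp only [sub_eq_zero]
  refine ⟨T, hT, hs, fun m q => ?_⟩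
  rw [hm, ← hint]
  simp only [mul_assoc]

theorem fCoeff_zero (a₁ a₂ : ℝ) (W : ℝ × ℝ → ℝ)
    (h : (∫ x in Icc (0 : ℝ × ℝ) (a₁, a₂), W x) = 0) : fCoeff a₁ a₂ W 0 = 0 := by
  simp [fCoeff, pvec, integral_complex_ofReal, h]

theorem mul_pow_le_abs_pow_sub_pow (x y : ℝ) (hx : 0 ≤ x) (hy : 0 ≤ y) (n : ℕ) :
    |x - y| * y ^ n ≤ |x ^ (n + 1) - y ^ (n + 1)| := by
  have h := Commute.all x y |>.mul_geom_sum₂ (n + 1)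
  rw [← h, abs_mul]
  refine mul_le_mul_of_nonneg_left (le_trans ?_ (le_abs_self _)) (abs_nonneg _)
  refine le_trans (le_of_eq ?_) (Finset.single_le_sum (fun i _ => by positivity)
    (Finset.mem_range.mpr n.succ_pos))
  simp

theorem diagonal_estimates (l : ℕ) (hl : 6 ≤ l) (δ : ℝ) (hδ : 0 < δ)
    (k : ℝ) (hk : 1 < k)
    (hk' : 10 + 20 * l * 2 ^ l ≤ k ^ δ) (x : ℝ)
    (hx0 : 0 ≤ x) (hx : |x - k ^ 2| < 5 * k ^ (-4 * s1 l - 2 * δ)) :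
    |x ^ l - k ^ (2 * (l : ℝ))| ≤ k ^ (2 * (l : ℝ) - 2 - 4 * s1 l - δ) / 4 ∧
    ∀ y, 0 ≤ y → 2 * k ^ (-4 * s1 l - δ) < |x - y| →
      3 * k ^ (2 * (l : ℝ) - 2 - 4 * s1 l - δ) / 2 ≤ |y ^ l - k ^ (2 * (l : ℝ))| := by
  have hk0 : 0 < k := by linarith
  have hl6 : (6 : ℝ) ≤ l := by exact_mod_cast hl
  have hs : 0 < s1 l := by unfold s1; linarith
  have hkl : k ^ (2 * (l : ℝ)) = (k ^ 2) ^ l := by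
    rw [← pow_mul, ← rpow_natCast]; push_cast; rfl
  set P := k ^ (-4 * s1 l - δ) with hP
  have hPpos : 0 < P := rpow_pos_of_pos hk0 _
  have hD : 0 < k ^ δ := rpow_pos_of_pos hk0 _
  have hP2 : k ^ (-4 * s1 l - 2 * δ) * k ^ δ = P := by
    rw [← rpow_add hk0]; congr 1; ring
  have hR : k ^ (2 * (l : ℝ) - 2 - 4 * s1 l - δ) = P * (k ^ 2) ^ (l - 1) := by
    rw [← pow_mul, ← rpow_natCast, ← rpow_add hk0, Nat.cast_mul, Nat.cast_sub (by omega)]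
    congr 1
    push_cast
    ring
  have hP1 : P ≤ 1 := rpow_le_one_of_one_le_of_nonpos hk.le (by linarith)
  set Q := k ^ (-4 * s1 l - 2 * δ) with hQ
  have hQpos : 0 < Q := rpow_pos_of_pos hk0 _
  have hpow : (0 : ℝ) ≤ l * 2 ^ l := by positivity
  have hQP : 10 * Q ≤ P := by nlinarith
  have hk2 : 1 ≤ k ^ 2 := one_le_pow₀ hk.le
  rw [hkl, hR]
  have hlpos : l - 1 + 1 = l := by omega
  constructor
  · have h1 := abs_pow_sub_pow_le x (k ^ 2) l
    have hxk : x ≤ 2 * k ^ 2 := by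
      have := (abs_lt.mp hx).2
      linarith
    have h2 : max |x| |k ^ 2| ≤ 2 * k ^ 2 := by
      rw [abs_of_nonneg hx0, abs_of_nonneg (by positivity)]
      exact max_le hxk (by linarith)
    calc |x ^ l - (k ^ 2) ^ l| ≤ |x - k ^ 2| * l * max |x| |k ^ 2| ^ (l - 1) := h1
      _ ≤ 5 * Q * l * (2 * k ^ 2) ^ (l - 1) := by gcongr
      _ = (5 * l * 2 ^ (l - 1)) * Q * (k ^ 2) ^ (l - 1) := by rw [mul_pow]; ring
      _ ≤ (k ^ δ / 4) * Q * (k ^ 2) ^ (l - 1) := by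
        gcongr
        have h3 : (2 : ℝ) ^ (l - 1) ≤ 2 ^ l := pow_le_pow_right₀ (by norm_num) (by omega)
        have h4 : (l : ℝ) * 2 ^ (l - 1) ≤ l * 2 ^ l := by gcongr
        linarith
      _ = P * (k ^ 2) ^ (l - 1) / 4 := by rw [← hP2]; ring
  · intro y hy hxy
    have h1 := mul_pow_le_abs_pow_sub_pow y (k ^ 2) hy (by positivity) (l - 1)
    rw [hlpos] at h1
    have h2 : 3 / 2 * P ≤ |y - k ^ 2| := by
      have := abs_sub_le x (k ^ 2) y
      rw [abs_sub_comm (k ^ 2) y] at this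
      linarith
    refine le_trans ?_ h1
    have h3 : 3 / 2 * P * (k ^ 2) ^ (l - 1) ≤ |y - k ^ 2| * (k ^ 2) ^ (l - 1) := by gcongr
    linarith

theorem isSolution_iff {d : ℤ × ℤ → ℝ} {w : ℤ × ℤ → ℂ} {α : ℝ} {z : ℂ}
    {T : lp (fun _ : ℤ × ℤ => ℂ) 2 →L[ℂ] lp (fun _ : ℤ × ℤ => ℂ) 2}
    (hT : ∀ f g, inner ℂ (T f) g = inner ℂ f (T g))
    (hw : ∀ m q, T (lp.single 2 q 1) m = w (m - q)) (f : lp (fun _ : ℤ × ℤ => ℂ) 2) :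
    IsSolution (fun m => (d m : ℂ)) (fun q => (α : ℂ) * w q) z f ↔
      ∀ m, (d m : ℂ) * f m + ((α : ℂ) • T) f m = z * f m := by
  have h : ∀ m, HasSum (fun q => (α : ℂ) * w (m - q) * f q) (((α : ℂ) • T) f m) := fun m => by
    have := (hasSum_symmetric_operator T hT f m).mul_left (α : ℂ)
    simp only [hw, ← mul_assoc] at this
    exact this
  constructor
  · rintro ⟨-, -, h3⟩ m
    rw [← (h m).tsum_eq]
    exact h3 m
  · intro h3
    refine ⟨lp.memℓp f, fun m => (h m).summable.norm, fun m => ?_⟩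
    rw [(h m).tsum_eq]
    exact h3 m

/-- Theorem 2.3 and Corollary 2.4: unique nonresonant eigenvalue in the first step. -/
theorem statement1 (l : ℕ) (hl : 6 ≤ l) (δ b₁ b₂ C_W : ℝ)
    (hδ : 0 < δ) (hδ' : 2 * δ < 2 * (l : ℝ) - 2 - 4 * s1 l)
    (hb₁ : 0 < b₁) (hb₂ : 0 < b₂) :
    ∃ k₀ : ℝ, ∀ k : ℝ, k₀ < k → 1 < k →
    ∀ a₁ a₂ : ℝ,
      k ^ s1 l * b₁ / 4 ≤ a₁ → a₁ ≤ k ^ s1 l * b₁ →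
      k ^ s1 l * b₂ / 4 ≤ a₂ → a₂ ≤ k ^ s1 l * b₂ →
    ∀ W : ℝ × ℝ → ℝ, Measurable W → (∀ x, |W x| ≤ C_W) →
      (∀ x, W (x + (a₁, 0)) = W x) → (∀ x, W (x + (0, a₂)) = W x) →
      (∫ x in Icc (0 : ℝ × ℝ) (a₁, a₂), W x) = 0 →
    ∀ w : ℤ × ℤ → ℂ, (∀ j, w j = fCoeff a₁ a₂ W j) → Memℓp w 2 →
    ∀ t : ℝ × ℝ, ∀ j : ℤ × ℤ,
      |sq2 (t + pvec a₁ a₂ j) - k ^ 2| < 5 * k ^ (-4 * s1 l - 2 * δ) →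
      (∀ i : ℤ × ℤ, i ≠ j →
        2 * k ^ (-4 * s1 l - δ) < |sq2 (t + pvec a₁ a₂ j) - sq2 (t + pvec a₁ a₂ i)|) →
    ∀ α : ℝ, α ∈ Icc (-1 : ℝ) 1 →
      ∃ lam : ℝ,
        lam ∈ Ioo (k ^ (2 * (l : ℝ)) - k ^ (2 * (l : ℝ) - 2 - 4 * s1 l - δ))
                  (k ^ (2 * (l : ℝ)) + k ^ (2 * (l : ℝ) - 2 - 4 * s1 l - δ)) ∧
        IsEigenvalue (fun m => ((sq2 (t + pvec a₁ a₂ m) ^ l : ℝ) : ℂ))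
          (fun q => (α : ℂ) * w q) (lam : ℂ) ∧
        IsSimpleEigenvalue (fun m => ((sq2 (t + pvec a₁ a₂ m) ^ l : ℝ) : ℂ))
          (fun q => (α : ℂ) * w q) (lam : ℂ) ∧
        |lam - sq2 (t + pvec a₁ a₂ j) ^ l| ≤
          2 * α ^ 2 * k ^ (2 * (l : ℝ) - 2 - 4 * s1 l - 2 * gam0 l δ - δ) ∧
        ∀ lam' : ℝ,
          lam' ∈ Ioo (k ^ (2 * (l : ℝ)) - k ^ (2 * (l : ℝ) - 2 - 4 * s1 l - δ))
                     (k ^ (2 * (l : ℝ)) + k ^ (2 * (l : ℝ) - 2 - 4 * s1 l - δ)) →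
          IsEigenvalue (fun m => ((sq2 (t + pvec a₁ a₂ m) ^ l : ℝ) : ℂ))
            (fun q => (α : ℂ) * w q) (lam' : ℂ) →
          lam' = lam := by
  have hδ0 := Filter.tendsto_atTop.mp (tendsto_rpow_atTop hδ)
    (16 * |C_W| + (10 + 20 * l * 2 ^ l))
  obtain ⟨k₀, hk₀⟩ := Filter.eventually_atTop.mp hδ0
  refine ⟨k₀, ?_⟩
  intro k hkk hk a₁ a₂ ha₁ _ ha₂ _ W hW hWb _ _ hW0 w hw _ t j hj hi α hα
  have hD := hk₀ k hkk.le
  have hk0 : 0 < k := by linarith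
  have hks : 0 < k ^ s1 l := rpow_pos_of_pos hk0 _
  have hp₁ : 0 < a₁ := lt_of_lt_of_le (by positivity) ha₁
  have hp₂ : 0 < a₂ := lt_of_lt_of_le (by positivity) ha₂
  have hC : 0 ≤ C_W := (abs_nonneg _).trans (hWb 0)
  rw [abs_of_nonneg hC] at hD
  obtain ⟨T, hT, hTs, hTm⟩ := exists_convolution_operator a₁ a₂ hp₁ hp₂ W hW C_W hWb
  have hTw : ∀ m q, T (lp.single 2 q 1) m = w (m - q) := fun m q => by rw [hTm, hw]
  have hsq : ∀ v, 0 ≤ sq2 v := fun v => by unfold sq2; positivity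
  obtain ⟨hdj, hdi⟩ := diagonal_estimates l hl δ hδ k hk (by linarith) _ (hsq _) hj
  set r := k ^ (2 * (l : ℝ) - 2 - 4 * s1 l - δ) with hr
  set E := k ^ (2 * (l : ℝ)) with hE
  have hrpos : 0 < r := rpow_pos_of_pos hk0 _
  have hrδ : k ^ δ ≤ r := rpow_le_rpow_of_exponent_le hk.le (by linarith)
  have hpow : (0 : ℝ) ≤ l * 2 ^ l := by positivity
  have hα1 : |α| ≤ 1 := abs_le.mpr hα
  have hα2 : |α| * C_W ≤ C_W := mul_le_of_le_one_left hC hα1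
  have hSn : ∀ f, ‖((α : ℂ) • T) f‖ ≤ |α| * C_W * ‖f‖ := fun f => by
    rw [smul_apply, norm_smul, Complex.norm_real, Real.norm_eq_abs, mul_assoc]
    exact mul_le_mul_of_nonneg_left (hT f) (abs_nonneg _)
  have hSs : ∀ f g, inner ℂ (((α : ℂ) • T) f) g = inner ℂ f (((α : ℂ) • T) g) := fun f g => by
    simp only [smul_apply, inner_smul_left, inner_smul_right,
      Complex.conj_ofReal, hTs]
  have hSj : ((α : ℂ) • T) (lp.single 2 j 1) j = 0 := by
    rw [smul_apply, lp.coeFn_smul, Pi.smul_apply, hTm, sub_self,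
      fCoeff_zero a₁ a₂ W hW0, smul_zero]
  obtain ⟨x, f, hxE, hfj, hf, hxd, huniq⟩ := exists_unique_perturbed_eigenpair
    (fun m => sq2 (t + pvec a₁ a₂ m) ^ l) j ((α : ℂ) • T) (|α| * C_W) r E (by positivity) hrpos
    (by linarith) hSn hSs hSj hdj fun i hij => hdi _ (hsq _) (hi i hij)
  have hIoo : ∀ z : ℝ, z ∈ Ioo (E - r) (E + r) ↔ |z - E| < r := fun z => by
    rw [abs_lt, mem_Ioo]
    constructor <;> rintro ⟨h1, h2⟩ <;> constructor <;> linarith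
  have hsol := (isSolution_iff (z := x) hTs hTw f).mpr hf
  have hf0 : (f : ℤ × ℤ → ℂ) ≠ 0 := fun h => by
    rw [h] at hfj
    exact zero_ne_one hfj
  have hbound : 2 * (|α| * C_W) ^ 2 / r ≤
      2 * α ^ 2 * k ^ (2 * (l : ℝ) - 2 - 4 * s1 l - 2 * gam0 l δ - δ) := by
    have h1 : k ^ (2 * (l : ℝ) - 2 - 4 * s1 l - 2 * gam0 l δ - δ) * r = (k ^ δ) ^ 2 := by
      rw [hr, ← rpow_add hk0, ← rpow_natCast, ← rpow_mul hk0.le]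
      congr 1
      unfold gam0
      push_cast
      ring
    have h2 : C_W ^ 2 ≤ (k ^ δ) ^ 2 := pow_le_pow_left₀ hC (by linarith) 2
    rw [div_le_iff₀ hrpos, mul_assoc, h1, mul_pow, sq_abs, ← mul_assoc]
    gcongr
  refine ⟨x, (hIoo x).mpr hxE, ⟨f, hsol, hf0⟩, ⟨f, hsol, hf0, fun g hg => ?_⟩,
    hxd.trans hbound, fun z hz => ?_⟩
  · by_cases hg0 : g = 0
    · exact ⟨0, by rw [hg0, zero_smul]⟩
    · let g' : lp (fun _ : ℤ × ℤ => ℂ) 2 := ⟨g, hg.1⟩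
      obtain ⟨-, h⟩ := huniq x g' hxE ((isSolution_iff hTs hTw g').mp hg)
        fun h => hg0 (congrArg (fun y : lp (fun _ : ℤ × ℤ => ℂ) 2 => (y : ℤ × ℤ → ℂ)) h)
      exact ⟨g j, congrArg (fun y : lp (fun _ : ℤ × ℤ => ℂ) 2 => (y : ℤ × ℤ → ℂ)) h⟩
  · rintro ⟨g, hg, hg0⟩
    let g' : lp (fun _ : ℤ × ℤ => ℂ) 2 := ⟨g, hg.1⟩
    exact (huniq z g' ((hIoo z).mp hz) ((isSolution_iff hTs hTw g').mp hg)
      fun h => hg0 (congrArg (fun y : lp (fun _ : ℤ × ℤ => ℂ) 2 => (y : ℤ × ℤ → ℂ)) h)).1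
end
end

section
/- (Geometric Lemma 2.1, part 2: stability of nonresonance in a complex neighborhood.) For sufficiently large k (depending only on l, δ, b₁, b₂) the following holds. If x ∈ ℝ² with |x| = k satisfies | |x + p_m(0)|² − k² | > 2·k^{−4s₁−δ} for all m ∈ ℤ²∖{0}, then every y ∈ ℂ² with |y − x| ≤ 2·k^{−1−4s₁−2δ} satisfies | |y|²_* − k² | < 5·k^{−4s₁−2δ}, and | |y + p_m(0)|²_* − k² | > k^{−4s₁−δ} for every m ∈ ℤ²∖{0}; in particular, m = 0 is the unique index m ∈ ℤ² with | |y + p_m(0)|²_* − k² | < 5·k^{−4s₁−2δ}. -/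
open Real Set

noncomputable section

lemma cx_add (v w : ℝ × ℝ) : cx (v + w) = cx v + cx w := by
  simp [cx]

lemma norm_nsq_add_sub_le (v : ℝ × ℝ) (d : ℂ × ℂ) :
    ‖nsq (cx v + d) - (sq2 v : ℂ)‖ ≤ 2 * (√(sq2 v) * cnorm d) + cnorm d ^ 2 := by
  have hsq : cnorm d ^ 2 = ‖d.1‖ ^ 2 + ‖d.2‖ ^ 2 := Real.sq_sqrt (by positivity)
  have hcs : |v.1| * ‖d.1‖ + |v.2| * ‖d.2‖ ≤ √(sq2 v) * cnorm d := by
    rw [cnorm, ← Real.sqrt_mul (by unfold sq2; positivity)]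
    apply Real.le_sqrt_of_sq_le
    rw [sq2, ← sq_abs v.1, ← sq_abs v.2]
    nlinarith [sq_nonneg (|v.1| * ‖d.2‖ - |v.2| * ‖d.1‖)]
  have hexp : nsq (cx v + d) - (sq2 v : ℂ)
      = 2 * ((v.1 : ℂ) * d.1 + (v.2 : ℂ) * d.2) + (d.1 ^ 2 + d.2 ^ 2) := by
    simp only [nsq, cx, sq2, Prod.fst_add, Prod.snd_add]
    push_cast
    ring
  have hlin : ‖(v.1 : ℂ) * d.1 + (v.2 : ℂ) * d.2‖ ≤ |v.1| * ‖d.1‖ + |v.2| * ‖d.2‖ := by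
    refine (norm_add_le _ _).trans_eq ?_
    simp
  have hquad : ‖d.1 ^ 2 + d.2 ^ 2‖ ≤ ‖d.1‖ ^ 2 + ‖d.2‖ ^ 2 := by
    refine (norm_add_le _ _).trans_eq ?_
    simp
  rw [hexp]
  refine (norm_add_le _ _).trans ?_
  rw [norm_mul, Complex.norm_ofNat]
  linarith

/-- A perturbation `d` of size at most `2Tq/k` cannot destroy the nonresonance of `v`. -/
lemma lt_norm_nsq_add_sub {k T q : ℝ} (hk : 1 < k) (hT : 0 < T) (hT1 : T ≤ 1) (hq : 0 < q)
    (hq1 : q ≤ 1 / 100) {v : ℝ × ℝ} (hv : 2 * T < |sq2 v - k ^ 2|) {d : ℂ × ℂ}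
    (hd : k * cnorm d ≤ 2 * (T * q)) :
    T < ‖nsq (cx v + d) - (k : ℂ) ^ 2‖ := by
  have hpert := norm_nsq_add_sub_le v d
  have htri : |sq2 v - k ^ 2|
      ≤ ‖nsq (cx v + d) - (k : ℂ) ^ 2‖ + ‖nsq (cx v + d) - (sq2 v : ℂ)‖ := by
    have h := norm_sub_le (nsq (cx v + d) - (k : ℂ) ^ 2) (nsq (cx v + d) - (sq2 v : ℂ))
    rw [sub_sub_sub_cancel_left, ← Complex.ofReal_pow, ← Complex.ofReal_sub,
      Complex.norm_real, Real.norm_eq_abs] at h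
    simpa using h
  have hr : √(sq2 v) ^ 2 = sq2 v := Real.sq_sqrt (by unfold sq2; positivity)
  have hr0 : 0 ≤ √(sq2 v) := Real.sqrt_nonneg _
  have hc0 : 0 ≤ cnorm d := Real.sqrt_nonneg _
  generalize √(sq2 v) = r at *
  generalize cnorm d = c at *
  have hTq : T * q ≤ T * (1 / 100) := by gcongr
  have hc : c ≤ T / 50 := by nlinarith
  have hcc : c ^ 2 ≤ T / 50 := by nlinarith
  rcases le_or_gt r (4 * k) with h | h
  · have : r * c ≤ 4 * (k * c) := by nlinarith
    linarith
  · have hrc : r * c ≤ r * (1 / 50) := by gcongr; linarith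
    have habs := le_abs_self (sq2 v - k ^ 2)
    nlinarith

/-- Geometric Lemma 2.1, part 2: stability of nonresonance in a complex neighborhood. -/
theorem statement5 (l : ℕ) (hl : 6 ≤ l) (δ b₁ b₂ : ℝ) (hb₁ : 0 < b₁) (hb₂ : 0 < b₂)
    (hδ : 0 < δ) (hδ' : 2 * δ < 2 * (l : ℝ) - 2 - 4 * s1 l) :
    ∃ k₀ : ℝ, ∀ k : ℝ, k₀ < k → 1 < k →
      ∀ a₁ a₂ : ℝ,
        k ^ s1 l * b₁ / 4 ≤ a₁ → a₁ ≤ k ^ s1 l * b₁ →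
        k ^ s1 l * b₂ / 4 ≤ a₂ → a₂ ≤ k ^ s1 l * b₂ →
      ∀ x : ℝ × ℝ, sq2 x = k ^ 2 →
        (∀ m : ℤ × ℤ, m ≠ 0 →
          2 * k ^ (-4 * s1 l - δ) < |sq2 (x + pvec a₁ a₂ m) - k ^ 2|) →
      ∀ y : ℂ × ℂ, cnorm (y - cx x) ≤ 2 * k ^ (-1 - 4 * s1 l - 2 * δ) →
        ‖nsq y - (k : ℂ) ^ 2‖ < 5 * k ^ (-4 * s1 l - 2 * δ) ∧
        (∀ m : ℤ × ℤ, m ≠ 0 →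
          k ^ (-4 * s1 l - δ) < ‖nsq (y + cx (pvec a₁ a₂ m)) - (k : ℂ) ^ 2‖) ∧
        (∀ m : ℤ × ℤ,
          ‖nsq (y + cx (pvec a₁ a₂ m)) - (k : ℂ) ^ 2‖ < 5 * k ^ (-4 * s1 l - 2 * δ) →
          m = 0) := by
  have hev := ((tendsto_rpow_neg_atTop hδ).eventually_le_const
    (by norm_num : (0 : ℝ) < 1 / 100))
  obtain ⟨k₀, hk₀⟩ := Filter.eventually_atTop.1 hev
  refine ⟨k₀, fun k hkk hk a₁ a₂ _ _ _ _ x hx hres y hy => ?_⟩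
  have hk0 : 0 < k := by linarith
  have hs : 0 < s1 l := by
    have : (6 : ℝ) ≤ l := by exact_mod_cast hl
    unfold s1
    linarith
  have hq1 := hk₀ k hkk.le
  have hq : 0 < k ^ (-δ) := Real.rpow_pos_of_pos hk0 _
  have hT : 0 < k ^ (-4 * s1 l - δ) := Real.rpow_pos_of_pos hk0 _
  have hT1 : k ^ (-4 * s1 l - δ) ≤ 1 := Real.rpow_le_one_of_one_le_of_nonpos hk.le (by linarith)
  have hTq : k ^ (-4 * s1 l - 2 * δ) = k ^ (-4 * s1 l - δ) * k ^ (-δ) := by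
    rw [← Real.rpow_add hk0]
    ring_nf
  have hε : k * k ^ (-1 - 4 * s1 l - 2 * δ) = k ^ (-4 * s1 l - 2 * δ) := by
    rw [← Real.rpow_one_add' hk0.le (by linarith)]
    ring_nf
  have hd : k * cnorm (y - cx x) ≤ 2 * (k ^ (-4 * s1 l - δ) * k ^ (-δ)) := by
    rw [← hTq, ← hε]
    nlinarith
  have hc0 : 0 ≤ cnorm (y - cx x) := Real.sqrt_nonneg _
  rw [hTq]
  generalize k ^ (-4 * s1 l - δ) = T at *
  generalize k ^ (-δ) = q at *
  have hfar : ∀ m : ℤ × ℤ, m ≠ 0 →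
      T < ‖nsq (y + cx (pvec a₁ a₂ m)) - (k : ℂ) ^ 2‖ := fun m hm => by
    have h := lt_norm_nsq_add_sub hk hT hT1 hq hq1 (hres m hm) hd
    rwa [cx_add, show cx x + cx (pvec a₁ a₂ m) + (y - cx x) = y + cx (pvec a₁ a₂ m) by abel] at h
  refine ⟨?_, hfar, fun m hm => ?_⟩
  · have h := norm_nsq_add_sub_le x (y - cx x)
    rw [add_sub_cancel, hx, Real.sqrt_sq hk0.le, Complex.ofReal_pow] at h
    have hpos : 0 < T * q := mul_pos hT hq
    have hsmall : T * q ≤ 1 / 100 := by nlinarith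
    have hc : cnorm (y - cx x) ≤ 2 * (T * q) := by nlinarith
    nlinarith
  · by_contra hne
    have := hfar m hne
    nlinarith
end
end

section
/- (Corollary 2.2: separation of the symbol from the contour C₁.) For sufficiently large k (depending only on l, δ, b₁, b₂) the following holds. If x ∈ ℝ² with |x| = k satisfies | |x + p_m(0)|² − k² | > 2·k^{−4s₁−δ} for all m ∈ ℤ²∖{0}, then for every y ∈ ℂ² with |y − x| ≤ 2·k^{−1−4s₁−2δ}, every z ∈ ℂ with |z − k^{2l}| = k^{2l−2−4s₁−δ}, and every m ∈ ℤ²: 2·| |y + p_m(0)|_*^{2l} − z | > k^{2l−2−4s₁−δ}. -/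
open Real Set

noncomputable section

theorem norm_pow_succ_sub_pow_succ_le {a b : ℂ} {B : ℝ} (ha : ‖a‖ ≤ B) (hb : ‖b‖ ≤ B) (n : ℕ) :
    ‖a ^ (n + 1) - b ^ (n + 1)‖ ≤ (n + 1) * B ^ n * ‖a - b‖ := by
  have hB : 0 ≤ B := (norm_nonneg a).trans ha
  induction n with
  | zero => simp
  | succ n ih =>
    have e : a ^ (n + 1 + 1) - b ^ (n + 1 + 1)
        = a * (a ^ (n + 1) - b ^ (n + 1)) + (a - b) * b ^ (n + 1) := by ring
    calc ‖a ^ (n + 1 + 1) - b ^ (n + 1 + 1)‖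
        ≤ ‖a‖ * ‖a ^ (n + 1) - b ^ (n + 1)‖ + ‖a - b‖ * ‖b‖ ^ (n + 1) := by
          rw [e]
          refine (norm_add_le _ _).trans_eq ?_
          rw [norm_mul, norm_mul, norm_pow]
      _ ≤ B * ((n + 1) * B ^ n * ‖a - b‖) + ‖a - b‖ * B ^ (n + 1) := by gcongr
      _ = ((n + 1 : ℕ) + 1) * B ^ (n + 1) * ‖a - b‖ := by push_cast; ring

theorem abs_sub_mul_max_pow_le {P Q : ℝ} (hP : 0 ≤ P) (hQ : 0 ≤ Q) (n : ℕ) :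
    |P - Q| * max P Q ^ n ≤ |P ^ (n + 1) - Q ^ (n + 1)| := by
  wlog h : Q ≤ P generalizing P Q
  · rw [abs_sub_comm, max_comm, abs_sub_comm (P ^ (n + 1))]
    exact this hQ hP (le_of_not_ge h)
  have h1 : Q ^ n ≤ P ^ n := by gcongr
  rw [max_eq_left h, abs_of_nonneg (sub_nonneg.2 h)]
  refine le_trans ?_ (le_abs_self _)
  rw [pow_succ, pow_succ]
  nlinarith [mul_le_mul_of_nonneg_left h1 hQ]

theorem norm_nsq_sub_sq2_le (u : ℝ × ℝ) (y : ℂ × ℂ) {ε : ℝ} (h : cnorm (y - cx u) ≤ ε) :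
    ‖nsq y - (sq2 u : ℂ)‖ ≤ 2 * √(sq2 u) * ε + ε ^ 2 := by
  set v := y - cx u with hv
  have hs : 0 ≤ ‖v.1‖ ^ 2 + ‖v.2‖ ^ 2 := by positivity
  have hu : 0 ≤ sq2 u := by unfold sq2; positivity
  have hc0 : 0 ≤ cnorm v := Real.sqrt_nonneg _
  have hc : cnorm v ^ 2 = ‖v.1‖ ^ 2 + ‖v.2‖ ^ 2 := Real.sq_sqrt hs
  have hq : √(sq2 u) ^ 2 = |u.1| ^ 2 + |u.2| ^ 2 := by
    rw [Real.sq_sqrt hu, sq_abs, sq_abs, sq2]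
  have cs : |u.1| * ‖v.1‖ + |u.2| * ‖v.2‖ ≤ √(sq2 u) * cnorm v := by
    apply abs_le_of_sq_le_sq' _ (by positivity) |>.2
    rw [mul_pow, hc, hq]
    nlinarith [sq_nonneg (|u.1| * ‖v.2‖ - |u.2| * ‖v.1‖)]
  have e : nsq y - (sq2 u : ℂ)
      = (2 * (u.1 * v.1) + 2 * (u.2 * v.2)) + (v.1 ^ 2 + v.2 ^ 2) := by
    simp only [nsq, sq2, hv, cx, Prod.fst_sub, Prod.snd_sub]
    push_cast
    ring
  calc ‖nsq y - (sq2 u : ℂ)‖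
      ≤ (2 * (|u.1| * ‖v.1‖) + 2 * (|u.2| * ‖v.2‖)) + (‖v.1‖ ^ 2 + ‖v.2‖ ^ 2) := by
        rw [e]
        refine (norm_add_le _ _).trans (add_le_add ?_ ?_) <;>
          refine (norm_add_le _ _).trans_eq ?_ <;> simp
    _ ≤ 2 * √(sq2 u) * cnorm v + cnorm v ^ 2 := by rw [hc]; linarith
    _ ≤ 2 * √(sq2 u) * ε + ε ^ 2 := by gcongr

/-- A perturbation of size `ε ≤ 1` changes `(|u|²)^(n+1)` by `O(M^n √M ε)`, where `M ≥ max |u|² 1`. -/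
theorem norm_nsq_pow_sub_le (u : ℝ × ℝ) (y : ℂ × ℂ) {ε M : ℝ} (h : cnorm (y - cx u) ≤ ε)
    (hε : ε ≤ 1) (hM : 1 ≤ M) (huM : sq2 u ≤ M) (n : ℕ) :
    ‖nsq y ^ (n + 1) - (sq2 u : ℂ) ^ (n + 1)‖ ≤
      (3 * (n + 1) * 4 ^ n) * (√M * ε) * M ^ n := by
  have hε0 : 0 ≤ ε := (Real.sqrt_nonneg _).trans h
  have hu : 0 ≤ sq2 u := by unfold sq2; positivity
  have hsM : 1 ≤ √M := Real.one_le_sqrt.2 hM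
  have hsq : √M ^ 2 = M := Real.sq_sqrt (by linarith)
  have d : ‖nsq y - (sq2 u : ℂ)‖ ≤ 3 * (√M * ε) := by
    refine (norm_nsq_sub_sq2_le u y h).trans ?_
    have h1 : √(sq2 u) * ε ≤ √M * ε := by gcongr
    have h2 : ε * ε ≤ √M * ε := by gcongr; linarith
    nlinarith
  have nu : ‖(sq2 u : ℂ)‖ ≤ M := by
    rw [Complex.norm_real, Real.norm_of_nonneg hu]; exact huM
  have ny : ‖nsq y‖ ≤ 4 * M := by
    have h1 := norm_le_norm_add_norm_sub' (nsq y) (sq2 u : ℂ)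
    have h2 : √M * ε ≤ √M * √M := by gcongr; linarith
    nlinarith
  calc _ ≤ (n + 1) * (4 * M) ^ n * ‖nsq y - (sq2 u : ℂ)‖ :=
        norm_pow_succ_sub_pow_succ_le ny (by linarith) n
    _ ≤ (n + 1) * (4 * M) ^ n * (3 * (√M * ε)) := by gcongr
    _ = _ := by rw [mul_pow]; ring

theorem lt_two_mul_norm_nsq_pow_sub (n : ℕ) {k D τ ε : ℝ} (hk : 1 < k) (hD : 0 < D) (hD1 : D ≤ 1)
    (hτ : 0 < τ) (hε : k * ε = 2 * (D * τ)) (hτc : 100 * (3 * (n + 1) * 4 ^ n) * τ < 1)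
    (u : ℝ × ℝ) (hu : sq2 u = k ^ 2 ∨ 2 * D < |sq2 u - k ^ 2|)
    (y : ℂ × ℂ) (hy : cnorm (y - cx u) ≤ ε)
    (z : ℂ) (hz : ‖z - (k : ℂ) ^ (2 * (n + 1))‖ = (k ^ 2) ^ n * D) :
    (k ^ 2) ^ n * D < 2 * ‖nsq y ^ (n + 1) - z‖ := by
  set c : ℝ := 3 * (n + 1) * 4 ^ n with hc
  have hc1 : 1 ≤ c := by
    have : (1 : ℝ) ≤ 4 ^ n := one_le_pow₀ (by norm_num)
    have : (0 : ℝ) ≤ n := n.cast_nonneg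
    rw [hc]; nlinarith
  have hk2 : 1 < k ^ 2 := by nlinarith
  have hP : 0 ≤ sq2 u := by unfold sq2; positivity
  have hcτ : c * (D * τ) ≤ D / 100 := by nlinarith
  have hε0 : 0 < ε := by
    have : 0 < k * ε := by rw [hε]; positivity
    exact pos_of_mul_pos_right this (by linarith)
  have hcε : c * (k * ε) ≤ D / 50 := by rw [hε]; linarith
  have hcε1 : c * ε ≤ 1 / 50 := by nlinarith [mul_pos (by linarith : 0 < c) hε0]
  have hε1 : ε ≤ 1 := by nlinarith
  have hK : 0 < (k ^ 2) ^ n := by positivity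
  rw [pow_mul] at hz
  have key : ∀ M, k ^ 2 ≤ M → sq2 u ≤ M → ‖nsq y ^ (n + 1) - (sq2 u : ℂ) ^ (n + 1)‖ ≤
      c * (√M * ε) * M ^ n := fun M h1 h2 =>
    norm_nsq_pow_sub_le u y hy hε1 (by linarith) h2 n
  rcases hu with hu | hu
  · have h1 := key (k ^ 2) le_rfl hu.le
    rw [Real.sqrt_sq (by linarith), hu] at h1
    push_cast at h1
    have h2 : c * (k * ε) * (k ^ 2) ^ n ≤ D / 50 * (k ^ 2) ^ n := by gcongr
    have h3 := norm_sub_le_norm_sub_add_norm_sub z (nsq y ^ (n + 1)) (((k : ℂ) ^ 2) ^ (n + 1))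
    rw [hz, norm_sub_rev z] at h3
    have : 0 < (k ^ 2) ^ n * D := by positivity
    linarith
  · set M := max (sq2 u) (k ^ 2) with hM
    have hkM : k ^ 2 ≤ M := le_max_right _ _
    have h1 := key M hkM (le_max_left _ _)
    have hlow := abs_sub_mul_max_pow_le hP (by positivity : 0 ≤ k ^ 2) n
    rw [← hM] at hlow
    have hsq : √M ^ 2 = M := Real.sq_sqrt (by linarith)
    have hsM0 : 0 ≤ √M := Real.sqrt_nonneg _
    have hsmall : c * (√M * ε) ≤ |sq2 u - k ^ 2| / 8 := by
      by_cases hs : √M ≤ 2 * k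
      · have : c * (√M * ε) ≤ c * (2 * k * ε) := by gcongr
        linarith
      · push Not at hs
        have hMl : 4 * k ^ 2 < M := by rw [← hsq]; nlinarith
        have hMP : M = sq2 u := by
          rcases max_choice (sq2 u) (k ^ 2) with h | h
          · rw [hM, h]
          · rw [← hM] at h; nlinarith
        rw [← hMP, abs_of_nonneg (by linarith)]
        have : c * (√M * ε) ≤ √M * (1 / 50) := by
          calc _ = √M * (c * ε) := by ring
            _ ≤ _ := by gcongr
        nlinarith
    have hMn : (k ^ 2) ^ n ≤ M ^ n := by gcongr
    have hup : ‖nsq y ^ (n + 1) - (sq2 u : ℂ) ^ (n + 1)‖ ≤ |sq2 u - k ^ 2| / 8 * M ^ n :=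
      h1.trans (by gcongr)
    have hlow' : |sq2 u - k ^ 2| * M ^ n ≤ ‖(sq2 u : ℂ) ^ (n + 1) - ((k : ℂ) ^ 2) ^ (n + 1)‖ := by
      refine hlow.trans_eq ?_
      rw [← Real.norm_eq_abs, ← Complex.norm_real]
      push_cast
      rfl
    have hmain : 2 * D * (k ^ 2) ^ n ≤ |sq2 u - k ^ 2| * M ^ n := by gcongr
    have t1 := norm_sub_le_norm_sub_add_norm_sub (sq2 u ^ (n + 1) : ℂ) (nsq y ^ (n + 1))
      (((k : ℂ) ^ 2) ^ (n + 1))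
    have t2 := norm_sub_le_norm_sub_add_norm_sub (nsq y ^ (n + 1)) z (((k : ℂ) ^ 2) ^ (n + 1))
    rw [norm_sub_rev] at hup
    rw [hz] at t2
    have : 0 < (k ^ 2) ^ n * D := by positivity
    linarith

/-- Corollary 2.2: separation of the symbol from the contour `C₁`. -/
theorem statement6 (l : ℕ) (hl : 6 ≤ l) (δ b₁ b₂ : ℝ) (hb₁ : 0 < b₁) (hb₂ : 0 < b₂)
    (hδ : 0 < δ) (hδ' : 2 * δ < 2 * (l : ℝ) - 2 - 4 * s1 l) :
    ∃ k₀ : ℝ, ∀ k : ℝ, k₀ < k → 1 < k →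
      ∀ a₁ a₂ : ℝ,
        k ^ s1 l * b₁ / 4 ≤ a₁ → a₁ ≤ k ^ s1 l * b₁ →
        k ^ s1 l * b₂ / 4 ≤ a₂ → a₂ ≤ k ^ s1 l * b₂ →
      ∀ x : ℝ × ℝ, sq2 x = k ^ 2 →
        (∀ m : ℤ × ℤ, m ≠ 0 →
          2 * k ^ (-4 * s1 l - δ) < |sq2 (x + pvec a₁ a₂ m) - k ^ 2|) →
      ∀ y : ℂ × ℂ, cnorm (y - cx x) ≤ 2 * k ^ (-1 - 4 * s1 l - 2 * δ) →
      ∀ z : ℂ, ‖z - (k : ℂ) ^ (2 * l)‖ = k ^ (2 * (l : ℝ) - 2 - 4 * s1 l - δ) →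
      ∀ m : ℤ × ℤ,
        k ^ (2 * (l : ℝ) - 2 - 4 * s1 l - δ) <
          2 * ‖nsq (y + cx (pvec a₁ a₂ m)) ^ l - z‖ := by
  obtain ⟨n, rfl⟩ : ∃ n, l = n + 1 := ⟨l - 1, by omega⟩
  have hs : 0 < s1 (n + 1) := by
    have : (6 : ℝ) ≤ ((n + 1 : ℕ) : ℝ) := by exact_mod_cast hl
    unfold s1
    linarith
  set s := s1 (n + 1)
  set c : ℝ := 3 * (n + 1) * 4 ^ n with hc
  obtain ⟨k₀, hk₀⟩ := Filter.eventually_atTop.1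
    ((tendsto_rpow_atTop hδ).eventually_gt_atTop (100 * c))
  refine ⟨k₀, fun k hkk hk a₁ a₂ _ _ _ _ x hx hsep y hy z hz m => ?_⟩
  have hk0 : 0 < k := by linarith
  have hR : k ^ (2 * ((n + 1 : ℕ) : ℝ) - 2 - 4 * s - δ) = (k ^ 2) ^ n * k ^ (-4 * s - δ) := by
    rw [← pow_mul, ← Real.rpow_natCast, ← Real.rpow_add hk0]
    congr 1
    push_cast
    ring
  rw [hR] at hz ⊢
  refine lt_two_mul_norm_nsq_pow_sub n (τ := k ^ (-δ)) hk (by positivity)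
    (Real.rpow_le_one_of_one_le_of_nonpos hk.le (by linarith)) (by positivity) ?_ ?_
    (x + pvec a₁ a₂ m) ?_ (y + cx (pvec a₁ a₂ m)) (le_of_eq_of_le ?_ hy) z hz
  · have e : k ^ (-1 - 4 * s - 2 * δ) = k⁻¹ * (k ^ (-4 * s - δ) * k ^ (-δ)) := by
      rw [← Real.rpow_neg_one, ← Real.rpow_add hk0, ← Real.rpow_add hk0]
      congr 1
      ring
    rw [e]
    field_simp
  · rw [Real.rpow_neg hk0.le, ← div_eq_mul_inv, div_lt_one (by positivity)]
    exact hk₀ k hkk.le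
  · by_cases hm : m = 0
    · left
      rw [← hx]
      simp [hm, pvec, sq2]
    · exact Or.inr (hsep m hm)
  · congr 1
    ext <;> simp [cx]
end
end
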